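/- Let p be a prime and let A₁, A₂ ∈ ℤ/pℤ satisfy A₁ ≠ 0, A₂ ≠ 0, A₁ ≠ A₂, and A₁ + A₂ ≠ 0. Then the lattice L := {(a₁, a₂) ∈ ℤ² | a₁ • A₁ + a₂ • A₂ = 0 in ℤ/pℤ} is generated, as an additive group, by its nonnegative elements (a₁, a₂) with 2·(a₁ + a₂) ≤ p + 3. (This is the lattice form of: for G = ℤ/pℤ and V with exactly two distinct nontrivial characters that are not inverses of each other, β_field(G,V) ≤ (p+3)/2.) -/

import Mathlib

/-- The lattice `{(a₁, a₂) ∈ ℤ² | a₁ • A₁ + a₂ • A₂ = 0}` in `ℤ/pℤ`. -/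
def latChar (p : ℕ) (A₁ A₂ : ZMod p) : AddSubgroup (Fin 2 → ℤ) where
  carrier := {a | a 0 • A₁ + a 1 • A₂ = 0}
  zero_mem' := by simp
  add_mem' := by
    intro x y hx hy
    simp only [Set.mem_setOf_eq, Pi.add_apply, add_smul] at *
    rw [show x 0 • A₁ + y 0 • A₁ + (x 1 • A₂ + y 1 • A₂)
        = (x 0 • A₁ + x 1 • A₂) + (y 0 • A₁ + y 1 • A₂) by abel, hx, hy, add_zero]
  neg_mem' := by
    intro x hx
    simp only [Set.mem_setOf_eq, Pi.neg_apply, neg_smul] at *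
    rw [show -(x 0 • A₁) + -(x 1 • A₂) = -(x 0 • A₁ + x 1 • A₂) by abel, hx, neg_zero]

lemma mem_latChar {p : ℕ} {A₁ A₂ : ZMod p} {a : Fin 2 → ℤ} :
    a ∈ latChar p A₁ A₂ ↔ (a 0 : ZMod p) * A₁ + (a 1 : ZMod p) * A₂ = 0 := by
  change a 0 • A₁ + a 1 • A₂ = 0 ↔ _
  rw [zsmul_eq_mul, zsmul_eq_mul]

/-- The determinant of two elements of `latChar p A₁ A₂` is divisible by `p`. -/
lemma dvd_det_of_mem_latChar {p : ℕ} [Fact p.Prime] {A₁ A₂ : ZMod p} (h1 : A₁ ≠ 0)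
    {x y : Fin 2 → ℤ} (hx : x ∈ latChar p A₁ A₂) (hy : y ∈ latChar p A₁ A₂) :
    (p : ℤ) ∣ x 0 * y 1 - x 1 * y 0 := by
  rw [mem_latChar] at hx hy
  rw [← ZMod.intCast_zmod_eq_zero_iff_dvd]
  push_cast
  refine (mul_eq_zero.mp ?_).resolve_right h1
  linear_combination (y 1 : ZMod p) * hx - (x 1 : ZMod p) * hy

/-- Two elements of `latChar p A₁ A₂` with determinant `p` generate it. -/
lemma latChar_le_closure {p : ℕ} [Fact p.Prime] {A₁ A₂ : ZMod p} (h1 : A₁ ≠ 0)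
    {u w : Fin 2 → ℤ} (hu : u ∈ latChar p A₁ A₂) (hw : w ∈ latChar p A₁ A₂)
    (hdet : u 0 * w 1 - u 1 * w 0 = p) {S : Set (Fin 2 → ℤ)} (huS : u ∈ S) (hwS : w ∈ S) :
    latChar p A₁ A₂ ≤ AddSubgroup.closure S := by
  intro x hx
  obtain ⟨s, hs⟩ := dvd_det_of_mem_latChar h1 hx hw
  obtain ⟨t, ht⟩ := dvd_det_of_mem_latChar h1 hu hx
  have hp0 : (p : ℤ) ≠ 0 := by exact_mod_cast (Fact.out : p.Prime).ne_zero
  have hxe : x = s • u + t • w := by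
    funext i
    apply mul_left_cancel₀ hp0
    fin_cases i
    · simp only [Fin.zero_eta, Pi.add_apply, Pi.smul_apply, smul_eq_mul]
      linear_combination u 0 * hs + w 0 * ht - x 0 * hdet
    · simp only [Fin.mk_one, Pi.add_apply, Pi.smul_apply, smul_eq_mul]
      linear_combination u 1 * hs + w 1 * ht - x 1 * hdet
  rw [hxe]
  exact add_mem (zsmul_mem (AddSubgroup.subset_closure huS) s)
    (zsmul_mem (AddSubgroup.subset_closure hwS) t)

lemma exists_mul_eq_add {d n : ℤ} (hd : 0 < d) : ∃ e s : ℤ, e * d = n + s ∧ 0 ≤ s ∧ s < d := by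
  refine ⟨-(-n / d), -n % d, ?_, Int.emod_nonneg _ hd.ne', Int.emod_lt_of_pos _ hd⟩
  linear_combination -Int.mul_ediv_add_emod (-n) d

/-- For a prime `p` and `2 ≤ m ≤ p - 2`, the lattice `{(x, y) | x ≡ m * y mod p}` has two
nonnegative elements of degree at most `(p + 3) / 2` with determinant `p`. -/
lemma exists_small_basis {p : ℕ} (hp : p.Prime) {m : ℤ} (hm : 2 ≤ m) (hmp : m + 2 ≤ p) :
    ∃ u₀ u₁ w₀ w₁ : ℤ, (p : ℤ) ∣ u₀ - m * u₁ ∧ (p : ℤ) ∣ w₀ - m * w₁ ∧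
      0 ≤ u₀ ∧ 0 ≤ u₁ ∧ 0 ≤ w₀ ∧ 0 ≤ w₁ ∧ 2 * (u₀ + u₁) ≤ (p : ℤ) + 3 ∧
      2 * (w₀ + w₁) ≤ (p : ℤ) + 3 ∧ u₀ * w₁ - u₁ * w₀ = p := by
  have hodd : (p : ℤ) % 2 = 1 := by
    rcases hp.eq_two_or_odd with h | h <;> omega
  have hprime : ∀ d : ℤ, 2 ≤ d → d < p → ¬ d ∣ p := by
    intro d hd hdp hdvd
    lift d to ℕ using by omega
    rcases (Nat.dvd_prime hp).mp (by exact_mod_cast hdvd) with h | h <;> omega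
  generalize (p : ℤ) = P at *
  by_cases hmle : 2 * m ≤ P + 1
  · obtain ⟨a, r, har, hr0, hrm⟩ := exists_mul_eq_add (n := P) (show 0 < m by omega)
    have ha : 2 ≤ a := by
      by_contra! h
      nlinarith
    refine ⟨m, 1, r, a, ⟨0, by ring⟩, ⟨-1, by linear_combination -har⟩, by omega, by omega,
      by omega, by omega, by omega, ?_, by linear_combination har⟩
    rcases ha.eq_or_lt with rfl | ha
    · omega
    · nlinarith
  obtain ⟨d, rfl⟩ : ∃ d, m = P - d := ⟨P - m, by ring⟩
  obtain ⟨k, r, hk, hr0, hrd⟩ : ∃ k r : ℤ, k * d + r = P ∧ 0 ≤ r ∧ r < d :=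
    ⟨P / d, P % d, by rw [mul_comm]; exact Int.mul_ediv_add_emod P d,
      Int.emod_nonneg _ (by omega), Int.emod_lt_of_pos _ (by omega)⟩
  have hr : 1 ≤ r := by
    by_contra! h
    have hr_zero : r = 0 := by omega
    exact hprime d (by omega) (by omega) ⟨k, by linear_combination hr_zero - hk⟩
  have hk2 : 2 ≤ k := by
    by_contra! h
    nlinarith
  have hkdeg : 2 * (r + k) ≤ P + 3 := by
    nlinarith [mul_nonneg (sub_nonneg.2 hk2) (show 0 ≤ d - 2 by omega)]
  by_cases hkr : 3 ≤ k ∨ r = 1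
  · refine ⟨r + d, k - 1, r, k, ⟨2 - k, by linear_combination hk⟩,
      ⟨1 - k, by linear_combination hk⟩, by omega, by omega, by omega, by omega, ?_, hkdeg,
      by linear_combination hk⟩
    rcases hkr with h | rfl
    · nlinarith [mul_nonneg (sub_nonneg.2 h) (show 0 ≤ d - 2 by omega)]
    · nlinarith [mul_nonneg (sub_nonneg.2 hk2) (show 0 ≤ d - 2 by omega)]
  obtain rfl : k = 2 := by omega
  obtain ⟨e, s, hes, hs0, hsr⟩ := exists_mul_eq_add (n := d) (show 0 < r by omega)
  have he : 2 ≤ e := by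
    by_contra! h
    nlinarith
  have hr3 : 3 ≤ r := by omega
  refine ⟨r, 2, s, 2 * e + 1, ⟨-1, by linear_combination hk⟩,
    ⟨-(e + 1), by linear_combination e * hk - hes⟩, by omega, by omega, by omega, by omega,
    hkdeg, ?_, by linear_combination hk + 2 * hes⟩
  nlinarith [mul_nonneg (sub_nonneg.2 he) (sub_nonneg.2 hr3)]

/-- Let `p` be prime and `A₁, A₂ ∈ ℤ/pℤ` nonzero, distinct, and not inverse
(`A₁ + A₂ ≠ 0`). Then the lattice `L = {(a₁,a₂) | a₁ • A₁ + a₂ • A₂ = 0}` is generated, as an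
additive group, by its nonnegative elements `(a₁, a₂)` with `2(a₁ + a₂) ≤ p + 3`. -/
theorem stmt_11 (p : ℕ) (hp : p.Prime) (A₁ A₂ : ZMod p)
    (h1 : A₁ ≠ 0) (h2 : A₂ ≠ 0) (hne : A₁ ≠ A₂) (hinv : A₁ + A₂ ≠ 0) :
    AddSubgroup.closure
        {a | a ∈ latChar p A₁ A₂ ∧ (∀ i, 0 ≤ a i) ∧ 2 * (a 0 + a 1) ≤ (p : ℤ) + 3} =
      latChar p A₁ A₂ := by
  have : Fact p.Prime := ⟨hp⟩
  refine le_antisymm ((AddSubgroup.closure_le _).2 fun a ha => ha.1) ?_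
  obtain ⟨n, hnp, hnA⟩ : ∃ n : ℕ, n < p ∧ (n : ZMod p) * A₁ + A₂ = 0 :=
    ⟨(-A₂ / A₁).val, ZMod.val_lt _, by rw [ZMod.natCast_zmod_val]; field_simp; ring⟩
  have hn0 : n ≠ 0 := by
    rintro rfl
    exact h2 (by simpa using hnA)
  have hn1 : n ≠ 1 := by
    rintro rfl
    exact hinv (by simpa using hnA)
  have hnp1 : n + 1 ≠ p := by
    intro h
    have hc : (n : ZMod p) + 1 = 0 := by
      rw [← Nat.cast_add_one, h, ZMod.natCast_self]
    exact hne (by linear_combination A₁ * hc - hnA)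
  obtain ⟨u₀, u₁, w₀, w₁, hu, hw, hu₀, hu₁, hw₀, hw₁, hud, hwd, hdet⟩ :=
    exists_small_basis hp (m := n) (by omega) (by omega)
  have hmem : ∀ x y : ℤ, (p : ℤ) ∣ x - n * y → ![x, y] ∈ latChar p A₁ A₂ := by
    intro x y h
    rw [← ZMod.intCast_zmod_eq_zero_iff_dvd] at h
    push_cast at h
    rw [mem_latChar]
    simp only [Matrix.cons_val_zero, Matrix.cons_val_one]
    linear_combination A₁ * h + (y : ZMod p) * hnA
  refine latChar_le_closure h1 (hmem _ _ hu) (hmem _ _ hw) (by simpa using hdet)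
    ⟨hmem _ _ hu, ?_, by simpa using hud⟩ ⟨hmem _ _ hw, ?_, by simpa using hwd⟩
  · simp [Fin.forall_fin_two, hu₀, hu₁]
  · simp [Fin.forall_fin_two, hw₀, hw₁]
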